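/- arXiv:2310.05248 — 3 statements merged into one kernel-verified Lean document; each statement's English description precedes it below -/
import Mathlib

section
/- Let d be a positive integer and let G be an (X,Y)-bigraph with maximum degree at most d in which every cycle has length at least 4ed² + 1 (girth at least 4ed² + 1). If 𝒞 is a collection of pairwise vertex-disjoint cycles of G whose vertex sets together contain every vertex of X, then |𝒞| ≤ α_Λ(G); in fact there is a Λ-independent set S ⊆ X containing exactly one vertex from each cycle of 𝒞. -/
open Finset SimpleGraph
open scoped Classical

variable {V : Type*}

/-- `Λ_G(S)`: the set of vertices of `Y` having at least two neighbors in `S`. -/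
noncomputable def lamSet (G : SimpleGraph V) (Y S : Finset V) : Finset V :=
  Y.filter fun y => 1 < (S.filter fun x => G.Adj y x).card

/-- `def(G,S)`: the Λ-deficiency of the set `S`, namely `|S| - |Λ_G(S)|`. -/
noncomputable def lamDefSet (G : SimpleGraph V) (Y S : Finset V) : ℤ :=
  (S.card : ℤ) - ((lamSet G Y S).card : ℤ)

/-- `def(G)`: the Λ-deficiency of the bigraph, `max_{S ⊆ X} def(G,S)`. -/
noncomputable def lamDef (G : SimpleGraph V) (X Y : Finset V) : ℤ :=
  X.powerset.sup' (Finset.powerset_nonempty X) fun S => lamDefSet G Y S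

/-- `α_Λ(G)`: the maximum size of a Λ-independent subset of `X`. -/
noncomputable def alphaLam (G : SimpleGraph V) (X Y : Finset V) : ℕ :=
  (X.powerset.filter fun S => lamSet G Y S = ∅).sup Finset.card

/-- `G` is an `(X,Y)`-bigraph: `X, Y` partition the vertex set and every edge
joins a vertex of `X` to a vertex of `Y`. -/
def IsBigraph (G : SimpleGraph V) (X Y : Finset V) : Prop :=
  Disjoint X Y ∧ (∀ v, v ∈ X ∨ v ∈ Y) ∧
    ∀ ⦃u v⦄, G.Adj u v → (u ∈ X ∧ v ∈ Y) ∨ (u ∈ Y ∧ v ∈ X)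

/-- `P` is a path `X`-cover: a list of pairwise vertex-disjoint paths of `G`
whose vertex sets together contain every vertex of `X`. -/
def IsPathXCover (G : SimpleGraph V) (X : Finset V)
    (P : List (Σ u : V, Σ v : V, G.Walk u v)) : Prop :=
  (∀ p ∈ P, p.2.2.IsPath) ∧
    P.Pairwise (fun p q => ∀ w : V, w ∈ p.2.2.support → w ∉ q.2.2.support) ∧
    ∀ x ∈ X, ∃ p ∈ P, x ∈ p.2.2.support

/-- `P` is a set of pairwise vertex-disjoint paths of `G` whose union of vertex
sets intersects `X` exactly in `S`. -/
def IsPathExactCover (G : SimpleGraph V) (X S : Finset V)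
    (P : List (Σ u : V, Σ v : V, G.Walk u v)) : Prop :=
  (∀ p ∈ P, p.2.2.IsPath) ∧
    P.Pairwise (fun p q => ∀ w : V, w ∈ p.2.2.support → w ∉ q.2.2.support) ∧
    ∀ x ∈ X, ((∃ p ∈ P, x ∈ p.2.2.support) ↔ x ∈ S)

/-- `C` is a collection of pairwise vertex-disjoint cycles of `G` whose vertex
sets together contain every vertex of `X`. -/
def IsCycleXCover (G : SimpleGraph V) (X : Finset V)
    (C : List (Σ u : V, G.Walk u u)) : Prop :=
  (∀ c ∈ C, c.2.IsCycle) ∧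
    C.Pairwise (fun c d => ∀ w : V, w ∈ c.2.support → w ∉ d.2.support) ∧
    ∀ x ∈ X, ∃ c ∈ C, x ∈ c.2.support

/-- The functions choosing an element of `P i` for each `i`, such that no two choices with
indices in `S` are related by `R`. -/
noncomputable def partialTransversals {ι α : Type*} [Fintype ι] (R : α → α → Prop)
    (P : ι → Finset α) (S : Finset ι) : Finset (ι → α) :=
  (Fintype.piFinset P).filter fun f => ∀ i ∈ S, ∀ j ∈ S, i ≠ j → ¬ R (f i) (f j)

/-- Prescribing the choices at two indices outside `S` divides the number of partial
transversals by the sizes of the two parts. -/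
lemma card_filter_partialTransversals_mul_le {ι α : Type*} [Fintype ι] (R : α → α → Prop)
    (P : ι → Finset α) {S : Finset ι} {i j : ι} (hij : i ≠ j) (hi : i ∉ S) (hj : j ∉ S)
    (v u : α) :
    ((partialTransversals R P S).filter fun f => f i = v ∧ f j = u).card *
      ((P i).card * (P j).card) ≤ (partialTransversals R P S).card := by
  rw [← Finset.card_product, ← Finset.card_product]
  refine Finset.card_le_card_of_injOn
    (fun q => Function.update (Function.update q.1 i q.2.1) j q.2.2) ?_ ?_
  · rintro ⟨f, a, b⟩ h
    simp only [partialTransversals, Finset.coe_product, Set.mem_prod, Finset.mem_coe,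
      Finset.mem_filter, Fintype.mem_piFinset] at h ⊢
    obtain ⟨⟨⟨hf, hR⟩, -⟩, ha, hb⟩ := h
    refine ⟨fun k => ?_, fun k hk l hl hkl => ?_⟩
    · by_cases hkj : k = j
      · subst hkj; simpa using hb
      · by_cases hki : k = i
        · subst hki; simpa [hkj] using ha
        · simpa [hkj, hki] using hf k
    · have hne : ∀ m ∈ S, m ≠ i ∧ m ≠ j := fun m hm =>
        ⟨fun h => hi (h ▸ hm), fun h => hj (h ▸ hm)⟩
      simpa [hne k hk, hne l hl] using hR k hk l hl hkl
  · rintro ⟨f, a, b⟩ h ⟨f', a', b'⟩ h' heq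
    simp only [Finset.coe_product, Set.mem_prod, Finset.mem_coe, Finset.mem_filter] at h h'
    have key : ∀ k, Function.update (Function.update f i a) j b k =
        Function.update (Function.update f' i a') j b' k := fun k => congrFun heq k
    have hb : b = b' := by simpa using key j
    have ha : a = a' := by simpa [hij] using key i
    have hf : f = f' := by
      funext k
      by_cases hkj : k = j
      · rw [hkj, h.1.2.2, h'.1.2.2]
      · by_cases hki : k = i
        · rw [hki, h.1.2.1, h'.1.2.1]
        · simpa [hkj, hki] using key k
    rw [hf, ha, hb]

/-- If the parts all have size `t ≥ 4Δ`, where `Δ` bounds the degrees of `R`, then enlarging the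
index set by one element keeps at least half of the partial transversals. -/
lemma card_partialTransversals_le_two_mul {ι α : Type*} [Fintype ι] [Fintype α]
    (R : α → α → Prop) (hsymm : ∀ a b, R a b → R b a) (P : ι → Finset α)
    (hdisj : ∀ i j, i ≠ j → Disjoint (P i) (P j)) {t Δ : ℕ} (ht : 0 < t) (htΔ : 4 * Δ ≤ t)
    (hcard : ∀ i, (P i).card = t) (hΔ : ∀ v, (Finset.univ.filter (R v)).card ≤ Δ)
    (S : Finset ι) {i : ι} (hi : i ∉ S) :
    (partialTransversals R P S).card ≤ 2 * (partialTransversals R P (insert i S)).card := by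
  induction hn : S.card using Nat.strong_induction_on generalizing S i with
  | _ n ih =>
  set M := partialTransversals R P S with hM
  set B := M.filter fun f => ∃ j ∈ S, R (f i) (f j) with hB
  set Q : α → Finset (ι × α) := fun v =>
    (S ×ˢ Finset.univ).filter fun q => q.2 ∈ P q.1 ∧ R v q.2 with hQ
  set F : α → ι × α → Finset (ι → α) := fun v q =>
    (partialTransversals R P (S.erase q.1)).filter fun f => f i = v ∧ f q.1 = q.2 with hF
  have hQcard : ∀ v, (Q v).card ≤ Δ := fun v => by
    refine (Finset.card_le_card_of_injOn Prod.snd ?_ ?_).trans (hΔ v)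
    · intro q hq
      simp only [hQ, Finset.coe_filter, Set.mem_ofPred_eq] at hq
      simpa using hq.2.2
    · rintro ⟨j, u⟩ hq ⟨j', u'⟩ hq' (rfl : u = u')
      simp only [hQ, Finset.coe_filter, Set.mem_ofPred_eq] at hq hq'
      by_contra hne
      have hjj : j ≠ j' := fun h => hne (by rw [h])
      exact Finset.disjoint_left.1 (hdisj j j' hjj) hq.2.1 hq'.2.1
  have hFcard : ∀ v, ∀ q ∈ Q v, (F v q).card * (t * t) ≤ 2 * M.card := by
    rintro v ⟨j, u⟩ hq
    have hj : j ∈ S := by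
      simp only [hQ, Finset.mem_filter, Finset.mem_product] at hq
      exact hq.1.1
    have hij : i ≠ j := fun h => hi (h ▸ hj)
    have h1 := card_filter_partialTransversals_mul_le R P hij
      (fun h => hi (Finset.mem_of_mem_erase h)) (Finset.notMem_erase j S) v u
    rw [hcard, hcard] at h1
    have h2 := ih (S.erase j).card (hn ▸ Finset.card_erase_lt_of_mem hj) (S.erase j)
      (Finset.notMem_erase j S) rfl
    rw [Finset.insert_erase hj] at h2
    exact h1.trans h2
  have hBsub : B ⊆ (P i).biUnion fun v => (Q v).biUnion (F v) := by
    intro f hf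
    simp only [hB, hM, partialTransversals, Finset.mem_filter, Fintype.mem_piFinset] at hf
    obtain ⟨⟨hfP, hfR⟩, j, hj, hR⟩ := hf
    simp only [Finset.mem_biUnion]
    refine ⟨f i, hfP i, (j, f j), ?_, ?_⟩
    · simp [hQ, hj, hfP j, hR]
    · simp only [hF, partialTransversals, Finset.mem_filter, Fintype.mem_piFinset]
      exact ⟨⟨hfP, fun k hk l hl => hfR k (Finset.mem_of_mem_erase hk) l
        (Finset.mem_of_mem_erase hl)⟩, by simp⟩
  have hBcard : B.card * (t * t) ≤ t * (Δ * (2 * M.card)) := by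
    calc B.card * (t * t) ≤ (∑ v ∈ P i, ∑ q ∈ Q v, (F v q).card) * (t * t) := by
          gcongr
          exact (Finset.card_le_card hBsub).trans (Finset.card_biUnion_le.trans
            (Finset.sum_le_sum fun v _ => Finset.card_biUnion_le))
      _ = ∑ v ∈ P i, ∑ q ∈ Q v, (F v q).card * (t * t) := by
          simp only [Finset.sum_mul]
      _ ≤ ∑ v ∈ P i, ∑ q ∈ Q v, 2 * M.card :=
          Finset.sum_le_sum fun v _ => Finset.sum_le_sum fun q hq => hFcard v q hq
      _ ≤ ∑ v ∈ P i, Δ * (2 * M.card) := by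
          refine Finset.sum_le_sum fun v _ => ?_
          rw [Finset.sum_const, smul_eq_mul]
          exact Nat.mul_le_mul_right _ (hQcard v)
      _ = t * (Δ * (2 * M.card)) := by rw [Finset.sum_const, smul_eq_mul, hcard]
  have hBhalf : 2 * B.card ≤ M.card := by
    have h1 : B.card * t ≤ Δ * (2 * M.card) := by
      refine Nat.le_of_mul_le_mul_left ?_ ht
      calc t * (B.card * t) = B.card * (t * t) := by ring
        _ ≤ _ := hBcard
    have h2 : 4 * Δ * M.card ≤ t * M.card := Nat.mul_le_mul_right _ htΔ
    refine Nat.le_of_mul_le_mul_left ?_ ht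
    linarith
  have hsub : M \ B ⊆ partialTransversals R P (insert i S) := by
    intro f hf
    simp only [hB, hM, partialTransversals, Finset.mem_sdiff, Finset.mem_filter,
      Fintype.mem_piFinset] at hf ⊢
    obtain ⟨⟨hfP, hfR⟩, hfB⟩ := hf
    have hno : ∀ j ∈ S, ¬ R (f i) (f j) := fun j hj hR => hfB ⟨⟨hfP, hfR⟩, j, hj, hR⟩
    refine ⟨hfP, fun k hk l hl hkl => ?_⟩
    rcases Finset.mem_insert.1 hk with hki | hkS <;> rcases Finset.mem_insert.1 hl with hli | hlS
    · exact absurd (hki.trans hli.symm) hkl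
    · exact hki ▸ hno l hlS
    · exact fun h => hno k hkS (hsymm _ _ (hli ▸ h))
    · exact hfR k hkS l hlS hkl
  have h3 := Finset.card_le_card hsub
  have hBM : B ⊆ M := Finset.filter_subset _ M
  have h4 := Finset.card_sdiff_add_card_eq_card hBM
  omega

/-- Disjoint parts of size `t ≥ 4Δ` in a graph of maximum degree at most `Δ` have an independent
transversal. -/
lemma exists_independent_transversal {ι α : Type*} [Fintype ι] [Fintype α]
    (R : α → α → Prop) (hsymm : ∀ a b, R a b → R b a) (P : ι → Finset α)
    (hdisj : ∀ i j, i ≠ j → Disjoint (P i) (P j)) {t Δ : ℕ} (ht : 0 < t) (htΔ : 4 * Δ ≤ t)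
    (hcard : ∀ i, (P i).card = t) (hΔ : ∀ v, (Finset.univ.filter (R v)).card ≤ Δ) :
    ∃ f : ι → α, (∀ i, f i ∈ P i) ∧ ∀ i j, i ≠ j → ¬ R (f i) (f j) := by
  have hpos : ∀ S : Finset ι, 0 < (partialTransversals R P S).card := by
    intro S
    induction S using Finset.induction_on with
    | empty =>
      simp only [partialTransversals, Finset.notMem_empty, false_imp_iff, implies_true,
        Finset.filter_true, Fintype.card_piFinset, hcard]
      exact Finset.prod_pos fun _ _ => ht
    | insert i S hi ihS =>
      have := card_partialTransversals_le_two_mul R hsymm P hdisj ht htΔ hcard hΔ S hi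
      omega
  obtain ⟨f, hf⟩ := Finset.card_pos.1 (hpos Finset.univ)
  simp only [partialTransversals, Finset.mem_filter, Fintype.mem_piFinset, Finset.mem_univ,
    forall_true_left] at hf
  exact ⟨f, hf.1, hf.2⟩

/-- Vertices of `X` and `Y` alternate along a walk of an `(X,Y)`-bigraph. -/
lemma IsBigraph.length_support_le {V : Type*} {G : SimpleGraph V} {X Y : Finset V}
    (h : IsBigraph G X Y) {u v : V} (w : G.Walk u v) :
    w.support.length + (if u ∈ X then 1 else 0) ≤
      2 * (w.support.filter (· ∈ X)).length + 1 := by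
  induction w with
  | nil =>
    rename_i u
    by_cases hu : u ∈ X <;> simp [hu]
  | cons hadj w ih =>
    rename_i a b c
    rcases h.2.2 hadj with ⟨ha, hb⟩ | ⟨ha, hb⟩
    · have hb' : b ∉ X := Finset.disjoint_right.1 h.1 hb
      simp only [hb', ha, if_true, if_false, Walk.support_cons, List.length_cons,
        List.filter_cons, decide_true] at ih ⊢
      omega
    · have ha' : a ∉ X := Finset.disjoint_right.1 h.1 ha
      simp only [hb, ha', if_true, if_false, Walk.support_cons, List.length_cons,
        List.filter_cons, decide_false, Bool.false_eq_true] at ih ⊢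
      omega

lemma IsBigraph.length_le_of_isCycle {V : Type*} {G : SimpleGraph V} {X Y : Finset V}
    (h : IsBigraph G X Y) {u : V} {c : G.Walk u u} (hc : c.IsCycle) :
    c.length ≤ 2 * (X.filter (· ∈ c.support)).card + 2 := by
  have h1 := h.length_support_le c
  have h2 : (c.support.filter (· ∈ X)).length ≤ (c.support.tail.filter (· ∈ X)).length + 1 := by
    rw [← Walk.cons_tail_support c, List.filter_cons]
    split_ifs <;> simp
  have h3 : (c.support.tail.filter (· ∈ X)).length ≤ (X.filter (· ∈ c.support)).card := by
    rw [← List.toFinset_card_of_nodup (hc.support_nodup.filter _)]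
    refine Finset.card_le_card fun x hx => ?_
    simp only [List.mem_toFinset, List.mem_filter, decide_eq_true_eq, Finset.mem_filter] at hx ⊢
    exact ⟨hx.2, List.mem_of_mem_tail hx.1⟩
  rw [Walk.length_support] at h1
  omega

lemma card_filter_exists_adj_adj_le {V : Type*} [Fintype V] (G : SimpleGraph V)
    [DecidableRel G.Adj] {d : ℕ} (hdeg : ∀ v : V, G.degree v ≤ d) (v : V) :
    (Finset.univ.filter fun u => ∃ y, G.Adj v y ∧ G.Adj y u).card ≤ d ^ 2 := by
  have hsub : (Finset.univ.filter fun u => ∃ y, G.Adj v y ∧ G.Adj y u) ⊆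
      (G.neighborFinset v).biUnion fun y => G.neighborFinset y := by
    intro u hu
    simpa using hu
  refine (Finset.card_le_card hsub).trans ((Finset.card_biUnion_le_card_mul _ _ d
    fun y _ => ?_).trans ?_)
  · exact (G.card_neighborFinset_eq_degree y).trans_le (hdeg y)
  · rw [G.card_neighborFinset_eq_degree, sq]
    exact Nat.mul_le_mul_right _ (hdeg v)

/-- If `G` is an `(X,Y)`-bigraph with maximum degree at most
`d` and girth at least `4ed² + 1`, and `C` is a collection of pairwise
vertex-disjoint cycles covering `X`, then `|C| ≤ α_Λ(G)`; in fact there is a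
Λ-independent set `S ⊆ X` containing exactly one vertex from each cycle of `C`. -/
theorem high_girth_cycle_transversal {V : Type*} [Fintype V] (G : SimpleGraph V)
    [DecidableRel G.Adj] (X Y : Finset V) (hBG : IsBigraph G X Y)
    (d : ℕ) (hd : 1 ≤ d) (hdeg : ∀ v : V, G.degree v ≤ d)
    (hgirth : ∀ (u : V) (c : G.Walk u u), c.IsCycle →
      4 * Real.exp 1 * (d : ℝ) ^ 2 + 1 ≤ (c.length : ℝ))
    (C : List (Σ u : V, G.Walk u u)) (hC : IsCycleXCover G X C) :
    C.length ≤ alphaLam G X Y ∧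
      ∃ S ⊆ X, lamSet G Y S = ∅ ∧
        (∀ c ∈ C, ∃! x : V, x ∈ S ∧ x ∈ c.2.support) ∧
        (∀ x ∈ S, ∃ c ∈ C, x ∈ c.2.support) := by
  obtain ⟨hcyc, hpair, -⟩ := hC
  have hdisj : ∀ i j : Fin C.length, i ≠ j → ∀ w, w ∈ (C.get i).2.support →
      w ∉ (C.get j).2.support := by
    intro i j hij w hi hj
    rw [List.pairwise_iff_get] at hpair
    rcases lt_or_gt_of_ne hij with h | h
    · exact hpair i j h w hi hj
    · exact hpair j i h w hj hi
  have hlarge : ∀ i : Fin C.length,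
      4 * d ^ 2 ≤ (X.filter (· ∈ (C.get i).2.support)).card := by
    intro i
    have hci := hcyc _ (C.get_mem i)
    have h1 := hgirth _ _ hci
    have h2 : ((C.get i).2.length : ℝ) ≤
        2 * ((X.filter (· ∈ (C.get i).2.support)).card : ℝ) + 2 := by
      exact_mod_cast hBG.length_le_of_isCycle hci
    have h3 : (1 : ℝ) ≤ d := by exact_mod_cast hd
    have h4 := Real.exp_one_gt_d9
    have h5 : (4 * d ^ 2 : ℝ) ≤ ((X.filter (· ∈ (C.get i).2.support)).card : ℝ) := by
      nlinarith [mul_le_mul_of_nonneg_right h4.le (sq_nonneg (d : ℝ))]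
    exact_mod_cast h5
  choose P hPsub hPcard using fun i => Finset.exists_subset_card_eq (hlarge i)
  have hPX : ∀ i, ∀ x ∈ P i, x ∈ X ∧ x ∈ (C.get i).2.support := fun i x hx => by
    simpa using hPsub i hx
  obtain ⟨f, hfP, hfR⟩ := exists_independent_transversal
    (fun v u => ∃ y, G.Adj v y ∧ G.Adj y u) (fun a b ⟨y, h, h'⟩ => ⟨y, h'.symm, h.symm⟩) P
    (fun i j hij => Finset.disjoint_left.2 fun x hi hj =>
      hdisj i j hij x (hPX i x hi).2 (hPX j x hj).2)
    (by positivity) le_rfl hPcard (fun v => by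
      convert card_filter_exists_adj_adj_le G hdeg v)
  have hfX : ∀ i, f i ∈ X := fun i => (hPX i _ (hfP i)).1
  have hfC : ∀ i, f i ∈ (C.get i).2.support := fun i => (hPX i _ (hfP i)).2
  have hinj : Function.Injective f := fun i j hij => by
    by_contra hne
    exact hdisj i j hne (f i) (hfC i) (hij ▸ hfC j)
  set S := Finset.univ.image f with hS
  have hSX : S ⊆ X := by
    intro x hx
    obtain ⟨i, -, rfl⟩ := Finset.mem_image.1 hx
    exact hfX i
  have hlam : lamSet G Y S = ∅ := by
    refine Finset.filter_eq_empty_iff.2 fun y _ hy => ?_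
    obtain ⟨a, ha, b, hb, hab⟩ := Finset.one_lt_card.1 hy
    simp only [hS, Finset.mem_filter, Finset.mem_image, Finset.mem_univ, true_and] at ha hb
    obtain ⟨⟨i, rfl⟩, hya⟩ := ha
    obtain ⟨⟨j, rfl⟩, hyb⟩ := hb
    exact hfR i j (fun h => hab (h ▸ rfl)) ⟨y, hya.symm, hyb⟩
  refine ⟨?_, S, hSX, hlam, fun c hc => ?_, fun x hx => ?_⟩
  · have hcard : S.card = C.length := by
      rw [hS, Finset.card_image_of_injective _ hinj, Finset.card_univ, Fintype.card_fin]
    rw [← hcard]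
    exact Finset.le_sup (f := Finset.card)
      (Finset.mem_filter.2 ⟨Finset.mem_powerset.2 hSX, hlam⟩)
  · obtain ⟨i, rfl⟩ := List.get_of_mem hc
    refine ⟨f i, ⟨Finset.mem_image_of_mem f (Finset.mem_univ i), hfC i⟩, ?_⟩
    rintro x ⟨hx, hxi⟩
    obtain ⟨j, -, rfl⟩ := Finset.mem_image.1 hx
    by_contra hne
    exact hdisj j i (fun h => hne (h ▸ rfl)) _ (hfC j) hxi
  · obtain ⟨i, -, rfl⟩ := Finset.mem_image.1 hx
    exact ⟨C.get i, C.get_mem i, hfC i⟩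
end

section
/- Let G be an (X,Y)-bigraph with maximum degree at most 3 and let k be a nonnegative integer. Then def(G) ≤ k if and only if for every subset S ⊆ X there exists a set of at most k pairwise vertex-disjoint paths of G whose union of vertex sets intersects X exactly in S. -/
open Finset SimpleGraph
open scoped Classical

variable {V : Type*}

/-- `l` is the vertex list of a path of `G` inside `X ∪ Y` whose two ends lie in `X`. -/
structure IsXPath (G : SimpleGraph V) (X Y : Finset V) (l : List V) : Prop where
  chain : l.IsChain G.Adj
  nodup : l.Nodup
  mem : ∀ v ∈ l, v ∈ X ∨ v ∈ Y
  head : ∃ a ∈ X, l.head? = some a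
  last : ∃ a ∈ X, l.getLast? = some a

/-- `X` and `Y` are disjoint independent sets, and each vertex of `Y` has at most three neighbors. -/
structure IsThinBigraph (G : SimpleGraph V) (X Y : Finset V) : Prop where
  disj : ∀ v ∈ X, v ∉ Y
  indepX : ∀ a ∈ X, ∀ b ∈ X, ¬ G.Adj a b
  indepY : ∀ a ∈ Y, ∀ b ∈ Y, ¬ G.Adj a b
  deg : ∀ y ∈ Y, ∀ l : List V, l.Nodup → (∀ a ∈ l, G.Adj y a) → l.length ≤ 3

lemma List.exists_last_split {α : Type*} (p : α → Prop) (t : List α) (h : ∃ x ∈ t, p x) :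
    ∃ t₁ x t₂, t = t₁ ++ x :: t₂ ∧ p x ∧ ∀ c ∈ t₂, ¬ p c := by
  induction t with
  | nil => simp at h
  | cons a t ih =>
    by_cases h' : ∃ x ∈ t, p x
    · obtain ⟨t₁, x, t₂, rfl, hx, hc⟩ := ih h'
      exact ⟨a :: t₁, x, t₂, rfl, hx, hc⟩
    · push Not at h'
      obtain ⟨x, hx, hpx⟩ := h
      rcases List.mem_cons.1 hx with rfl | hx
      · exact ⟨[], x, t, rfl, hpx, h'⟩
      · exact absurd hpx (h' x hx)

namespace IsXPath

variable {G : SimpleGraph V} {X Y : Finset V}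

lemma singleton {a : V} (ha : a ∈ X) : IsXPath G X Y [a] :=
  ⟨by simp, by simp, by simp [ha], ⟨a, ha, rfl⟩, ⟨a, ha, rfl⟩⟩

lemma reverse {l : List V} (h : IsXPath G X Y l) : IsXPath G X Y l.reverse := by
  refine ⟨?_, by simpa using h.nodup, by simpa using h.mem, ?_, ?_⟩
  · rw [List.isChain_reverse]
    exact h.chain.imp fun _ _ hab => hab.symm
  · simpa using h.last
  · simpa using h.head

lemma cons_cons {l : List V} {a y b : V} (h : IsXPath G X Y (b :: l)) (ha : a ∈ X) (hy : y ∈ Y)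
    (hay : G.Adj a y) (hyb : G.Adj y b) (hal : a ∉ b :: l) (hyl : y ∉ b :: l) :
    IsXPath G X Y (a :: y :: b :: l) := by
  refine ⟨?_, ?_, ?_, ⟨a, ha, rfl⟩, ?_⟩
  · simp [hay, hyb, h.chain]
  · refine List.nodup_cons.2 ⟨?_, List.nodup_cons.2 ⟨hyl, h.nodup⟩⟩
    rw [List.mem_cons]
    rintro (rfl | h')
    · exact hay.ne rfl
    · exact hal h'
  · intro v hv
    rcases List.mem_cons.1 hv with rfl | hv
    · exact .inl ha
    rcases List.mem_cons.1 hv with rfl | hv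
    · exact .inr hy
    exact h.mem v hv
  · simpa using h.last

lemma left_of_append {l₁ l₂ : List V} {x : V} (h : IsXPath G X Y (l₁ ++ x :: l₂)) (hx : x ∈ X) :
    IsXPath G X Y (l₁ ++ [x]) := by
  have e : l₁ ++ x :: l₂ = (l₁ ++ [x]) ++ l₂ := by simp
  obtain ⟨h1, h2, h3, h4, h5⟩ := h
  refine ⟨?_, ?_, ?_, ?_, ⟨x, hx, by simp⟩⟩
  · rw [e] at h1
    exact (List.isChain_append.1 h1).1
  · rw [e] at h2
    exact (List.nodup_append.1 h2).1
  · intro v hv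
    exact h3 v (by rw [e]; exact List.mem_append_left _ hv)
  · cases l₁ <;> simpa using h4

lemma right_of_append {l₁ l₂ : List V} {x : V} (h : IsXPath G X Y (l₁ ++ x :: l₂)) (hx : x ∈ X) :
    IsXPath G X Y (x :: l₂) := by
  obtain ⟨h1, h2, h3, h4, h5⟩ := h
  refine ⟨(List.isChain_append.1 h1).2.1, (List.nodup_append.1 h2).2.1, ?_, ⟨x, hx, rfl⟩, ?_⟩
  · intro v hv
    exact h3 v (List.mem_append_right _ hv)
  · simpa [List.getLast?_append] using h5

lemma exists_split (hG : IsThinBigraph G X Y) {l : List V} (h : IsXPath G X Y l) {y : V}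
    (hy : y ∈ Y) (hyl : y ∈ l) :
    ∃ s p q t, l = s ++ p :: y :: q :: t ∧ G.Adj y p ∧ G.Adj y q ∧ p ∈ X ∧ q ∈ X ∧ p ≠ q := by
  obtain ⟨s, t, rfl⟩ := List.append_of_mem hyl
  obtain ⟨h1, h2, h3, ⟨a, ha, h4⟩, ⟨b, hb, h5⟩⟩ := h
  rcases List.eq_nil_or_concat s with rfl | ⟨s, p, rfl⟩
  · simp only [List.nil_append, List.head?_cons, Option.some.injEq] at h4
    subst h4
    exact absurd hy (hG.disj _ ha)
  rcases t with _ | ⟨q, t⟩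
  · simp only [List.getLast?_append, List.getLast?_singleton, Option.some_or,
      Option.some.injEq] at h5
    subst h5
    exact absurd hy (hG.disj _ hb)
  have e : s.concat p ++ y :: q :: t = s ++ p :: y :: q :: t := by simp
  rw [e] at h1 h2 h3
  have hc := (List.isChain_append.1 h1).2.1
  simp only [List.isChain_cons_cons] at hc
  have hn := (List.nodup_append.1 h2).2.1
  refine ⟨s, p, q, t, e, hc.1.symm, hc.2.1, ?_, ?_, ?_⟩
  · exact (h3 p (by simp)).resolve_right fun h => hG.indepY _ h _ hy hc.1
  · exact (h3 q (by simp)).resolve_right fun h => hG.indepY _ hy _ h hc.2.1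
  · rintro rfl
    simp at hn

/-- In a longest path starting at `v`, a neighbor of `v` with a neighbor outside the path is the
second vertex. -/
lemma exists_eq_cons_cons (hG : IsThinBigraph G X Y) {v y a : V} {l : List V}
    (h : IsXPath G X Y (v :: l)) (hmax : ∀ l', IsXPath G X Y l' → l'.length ≤ l.length + 1)
    (hy : y ∈ Y) (hyv : G.Adj y v) (ha : a ∈ X) (hya : G.Adj y a) (hal : a ∉ v :: l) :
    ∃ t, l = y :: t := by
  have hv : v ∈ X := by simpa using h.head
  by_cases hyl : y ∈ v :: l
  · obtain ⟨s, p, q, t, e, hp, hq, hpX, hqX, hpq⟩ := h.exists_split hG hy hyl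
    rcases s with _ | ⟨b, s⟩
    · exact ⟨q :: t, (List.cons.inj e).2⟩
    · obtain ⟨rfl, rfl⟩ := List.cons.inj e
      have hn := h.nodup
      have := hG.deg y hy [v, a, p, q] (by
        simp only [List.append_eq, List.mem_cons, List.mem_append, List.nodup_cons, not_or] at *
        simp only [List.not_mem_nil, not_false_eq_true, List.nodup_nil, and_true]
        tauto) (by simp [hp, hq, hyv, hya])
      simp at this
  · have := hmax _ (h.cons_cons ha hy hya.symm hyv hal hyl)
    simp at this

end IsXPath

/-- Deleting the path `Q` lowers the deficiency: adding `A` to a set that avoids `Q` puts no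
vertex into its `Λ`-set except those of `B`, where `B` has one vertex fewer than `A`. -/
structure IsReducingPath (G : SimpleGraph V) (X Y : Finset V) (Q : List V) (A B : Finset V) :
    Prop where
  path : IsXPath G X Y Q
  subset : A ⊆ X
  mem : ∀ a ∈ A, a ∈ Q
  card : B.card + 1 = A.card
  nbr : ∀ y ∈ Y, y ∉ B → ∀ a ∈ A, G.Adj y a → ∀ c ∈ X, G.Adj y c → c ∈ Q ∧ (c ∈ A → c = a)

section Fork

variable {G : SimpleGraph V} {X Y : Finset V}

/-- Two longest paths which differ only in their first vertices. -/
structure IsFork (G : SimpleGraph V) (X Y : Finset V) (u w y : V) (t : List V) : Prop where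
  left : IsXPath G X Y (u :: y :: t)
  right : IsXPath G X Y (w :: y :: t)
  ne : u ≠ w
  max : ∀ l, IsXPath G X Y l → l.length ≤ t.length + 2

namespace IsFork

variable {u w y : V} {t : List V}

lemma symm (h : IsFork G X Y u w y t) : IsFork G X Y w u y t :=
  ⟨h.right, h.left, h.ne.symm, h.max⟩

lemma left_mem (h : IsFork G X Y u w y t) : u ∈ X := by simpa using h.left.head

lemma adj_left (h : IsFork G X Y u w y t) : G.Adj u y := by
  have := h.left.chain
  rw [List.isChain_cons] at this
  exact this.1 y rfl

lemma mid_mem (hG : IsThinBigraph G X Y) (h : IsFork G X Y u w y t) : y ∈ Y :=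
  (h.left.mem y (by simp)).resolve_left fun hy => hG.indepX _ h.left_mem _ hy h.adj_left

lemma left_notMem (h : IsFork G X Y u w y t) : u ∉ t := by
  have := h.left.nodup
  simp only [List.nodup_cons, List.mem_cons, not_or] at this
  exact this.1.2

lemma mid_notMem (h : IsFork G X Y u w y t) : y ∉ t := by
  have := h.left.nodup
  simp only [List.nodup_cons] at this
  exact this.2.1

lemma exists_tail (hG : IsThinBigraph G X Y) (h : IsFork G X Y u w y t) :
    ∃ x t', t = x :: t' ∧ x ∈ X ∧ G.Adj y x := by
  have hy := h.mid_mem hG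
  rcases t with _ | ⟨x, t'⟩
  · have : y ∈ X := by simpa using h.left.last
    exact absurd hy (hG.disj _ this)
  · have := h.left.chain
    simp only [List.isChain_cons_cons] at this
    exact ⟨x, t', rfl, (h.left.mem x (by simp)).resolve_right
      fun hx => hG.indepY _ hy _ hx this.2.1, this.2.1⟩

lemma isXPath_tail (hG : IsThinBigraph G X Y) (h : IsFork G X Y u w y t) : IsXPath G X Y t := by
  obtain ⟨x, t', rfl, hx, -⟩ := h.exists_tail hG
  exact IsXPath.right_of_append (l₁ := [u, y]) h.left hx

lemma nbr_left (hG : IsThinBigraph G X Y) (h : IsFork G X Y u w y t) {y' c : V} (hy' : y' ∈ Y)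
    (hne : y' ≠ y) (hu : G.Adj y' u) (hc : c ∈ X) (hyc : G.Adj y' c) : c = u ∨ c ∈ t := by
  by_contra! hcon
  obtain ⟨t', ht'⟩ := IsXPath.exists_eq_cons_cons hG h.left (by simpa using h.max) hy' hu hc hyc (by
    simp only [List.mem_cons, not_or]
    refine ⟨hcon.1, ?_, hcon.2⟩
    rintro rfl
    exact hG.disj _ hc (h.mid_mem hG))
  exact hne (List.cons.inj ht').1.symm

lemma not_adj_both (hG : IsThinBigraph G X Y) (h : IsFork G X Y u w y t) {y' : V} (hy' : y' ∈ Y)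
    (hne : y' ≠ y) (hu : G.Adj y' u) (hw : G.Adj y' w) : False := by
  rcases h.nbr_left hG hy' hne hu h.symm.left_mem hw with h' | h'
  · exact h.ne h'.symm
  · exact h.symm.left_notMem h'

lemma nbr_mid (hG : IsThinBigraph G X Y) {x : V} (h : IsFork G X Y u w y (x :: t)) {c : V}
    (hyc : G.Adj y c) : c = u ∨ c = w ∨ c = x := by
  by_contra! hcon
  have h1 := h.left_notMem
  have h2 := h.symm.left_notMem
  have h3 : G.Adj y x := by
    obtain ⟨x', t', e, -, hx⟩ := h.exists_tail hG
    rwa [(List.cons.inj e).1]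
  simp only [List.mem_cons, not_or] at h1 h2
  have := hG.deg y (h.mid_mem hG) [c, u, w, x] (by simp [hcon, h1, h2, h.ne])
    (by simp [hyc, h.adj_left.symm, h.symm.adj_left.symm, h3])
  simp at this

/-- A vertex of the path adjacent to `u` and `x`, all of whose neighbors on the path are no
further than `x`, directly precedes `x`. -/
lemma exists_pred (hG : IsThinBigraph G X Y) (h : IsFork G X Y u w y t) {y' x : V}
    {t₁ t₂ : List V} (ht : t = t₁ ++ x :: t₂) (hy' : y' ∈ Y) (hyt : y' ∈ t) (hu : G.Adj y' u)
    (hx : G.Adj y' x) (hfar : ∀ c ∈ t₂, ¬ G.Adj y' c) :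
    ∃ s p, t₁ = s ++ [p, y'] ∧ p ∈ X ∧ G.Adj y' p := by
  have hpath := h.isXPath_tail hG
  have hn := hpath.nodup
  obtain ⟨s, p, q, t', e, hp, hq, hpX, hqX, hpq⟩ := hpath.exists_split hG hy' hyt
  have hut := h.left_notMem
  by_cases hxq : x = q
  · subst hxq
    have e' : t₁ ++ x :: t₂ = (s ++ [p, y']) ++ x :: t' := by rw [← ht, e]; simp
    rw [ht, List.nodup_middle, List.nodup_cons, List.mem_append, not_or] at hn
    have := (List.append_cons_inj_of_notMem hn.1.1 hn.1.2).1 e'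
    exact ⟨s, p, this.1, hpX, hp⟩
  · exfalso
    by_cases hxp : x = p
    · subst hxp
      rw [ht, List.nodup_middle, List.nodup_cons, List.mem_append, not_or] at hn
      have := (List.append_cons_inj_of_notMem hn.1.1 hn.1.2).1 (ht.symm.trans e)
      exact hfar q (by simp [this.2.2]) hq
    · have hxt : x ∈ t := by simp [ht]
      have hpt : p ∈ t := by simp [e]
      have hqt : q ∈ t := by simp [e]
      have hux : u ≠ x := fun h => hut (h ▸ hxt)
      have hup : u ≠ p := fun h => hut (h ▸ hpt)
      have huq : u ≠ q := fun h => hut (h ▸ hqt)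
      have := hG.deg y' hy' [u, x, p, q] (by simp [hux, hup, huq, hxp, hxq, hpq])
        (by simp [hu, hx, hp, hq])
      simp at this

lemma exists_reducing_of_no_return (hG : IsThinBigraph G X Y) (h : IsFork G X Y u w y t)
    (hW : ∀ x ∈ t, ∀ y' ∈ Y, y' ≠ y → (G.Adj y' u ∨ G.Adj y' w) → ¬ G.Adj y' x) :
    ∃ Q A B, IsReducingPath G X Y Q A B := by
  have hy := h.mid_mem hG
  have huX := h.left_mem
  have hwX := h.symm.left_mem
  refine ⟨[u, y, w], {u, w}, {y}, ?_, ?_, ?_, ?_, ?_⟩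
  · refine (IsXPath.singleton hwX).cons_cons huX hy h.adj_left h.symm.adj_left.symm ?_ ?_
    · simpa using h.ne
    · simpa using h.symm.adj_left.symm.ne
  · simp [Finset.insert_subset_iff, huX, hwX]
  · simp
  · simp [h.ne]
  · intro y' hy' hne a ha hya c hc hyc
    have hne : y' ≠ y := by simpa using hne
    have hca : c = a := by
      rcases Finset.mem_insert.1 ha with rfl | ha
      · exact (h.nbr_left hG hy' hne hya hc hyc).resolve_right fun hct =>
          hW c hct y' hy' hne (.inl hya) hyc
      · obtain rfl := Finset.mem_singleton.1 ha
        exact (h.symm.nbr_left hG hy' hne hya hc hyc).resolve_right fun hct =>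
          hW c hct y' hy' hne (.inr hya) hyc
    subst hca
    exact ⟨by simp at ha ⊢; tauto, fun _ => rfl⟩

/-- The furthest return to the path is through a vertex outside the path. -/
lemma exists_reducing_of_outside (hG : IsThinBigraph G X Y) (h : IsFork G X Y u w y t)
    {t₁ t₂ : List V} {x y' : V} (ht : t = t₁ ++ x :: t₂) (hx : x ∈ X)
    (hfar : ∀ c ∈ t₂, ∀ y' ∈ Y, y' ≠ y → (G.Adj y' u ∨ G.Adj y' w) → ¬ G.Adj y' c)
    (hy' : y' ∈ Y) (hne : y' ≠ y) (hu : G.Adj y' u) (hyx : G.Adj y' x) (hyt : y' ∉ t) :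
    ∃ Q A B, IsReducingPath G X Y Q A B := by
  have hy := h.mid_mem hG
  have huX := h.left_mem
  have hwX := h.symm.left_mem
  have hut := h.left_notMem
  have hwt := h.symm.left_notMem
  have hyt' := h.mid_notMem
  have hsub : ∀ c, c ∈ x :: t₁.reverse → c ∈ t := by
    intro c hc
    simp only [List.mem_cons, List.mem_reverse] at hc
    simp only [ht, List.mem_append, List.mem_cons]
    tauto
  have hR : IsXPath G X Y (x :: t₁.reverse) := by
    have := h.isXPath_tail hG
    rw [ht] at this
    simpa using (this.left_of_append hx).reverse
  have hQ₁ : IsXPath G X Y (u :: y' :: x :: t₁.reverse) :=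
    hR.cons_cons huX hy' hu.symm hyx (fun h => hut (hsub _ h)) (fun h => hyt (hsub _ h))
  have hQ : IsXPath G X Y (w :: y :: u :: y' :: x :: t₁.reverse) := by
    refine hQ₁.cons_cons hwX hy h.symm.adj_left h.adj_left.symm ?_ ?_
    · rw [List.mem_cons, List.mem_cons]
      rintro (rfl | rfl | h')
      · exact h.ne rfl
      · exact hG.disj _ hwX hy'
      · exact hwt (hsub _ h')
    · rw [List.mem_cons, List.mem_cons]
      rintro (rfl | rfl | h')
      · exact hG.disj _ huX hy
      · exact hne rfl
      · exact hyt' (hsub _ h')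
  refine ⟨_, {u, w}, {y}, hQ, ?_, ?_, ?_, ?_⟩
  · simp [Finset.insert_subset_iff, huX, hwX]
  · simp
  · simp [h.ne]
  · intro z hz hzne a ha hza c hc hzc
    have hzne : z ≠ y := by simpa using hzne
    have hza' : G.Adj z u ∨ G.Adj z w := by
      simp only [Finset.mem_insert, Finset.mem_singleton] at ha
      rcases ha with rfl | rfl
      exacts [.inl hza, .inr hza]
    have hca : c = a ∨ c ∈ t := by
      simp only [Finset.mem_insert, Finset.mem_singleton] at ha
      rcases ha with rfl | rfl
      · exact h.nbr_left hG hz hzne hza hc hzc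
      · exact h.symm.nbr_left hG hz hzne hza hc hzc
    constructor
    · rcases hca with rfl | hct
      · simp only [Finset.mem_insert, Finset.mem_singleton] at ha
        simp only [List.mem_cons]
        tauto
      · have := fun hc2 => hfar c hc2 z hz hzne hza' hzc
        simp only [ht, List.mem_append, List.mem_cons] at hct
        simp only [List.mem_cons, List.mem_reverse]
        tauto
    · intro hcA
      refine hca.resolve_right fun hct => ?_
      simp only [Finset.mem_insert, Finset.mem_singleton] at hcA
      rcases hcA with rfl | rfl
      exacts [hut hct, hwt hct]

/-- The furthest return to the path is through vertices of the path only. -/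
lemma exists_reducing_of_inside (hG : IsThinBigraph G X Y) (h : IsFork G X Y u w y t)
    {t₁ t₂ : List V} {x y' : V} (ht : t = t₁ ++ x :: t₂)
    (hfar : ∀ c ∈ t₂, ∀ y' ∈ Y, y' ≠ y → (G.Adj y' u ∨ G.Adj y' w) → ¬ G.Adj y' c)
    (hy' : y' ∈ Y) (hne : y' ≠ y) (hu : G.Adj y' u) (hyx : G.Adj y' x) (hyt : y' ∈ t)
    (hin : ∀ z ∈ Y, z ≠ y → G.Adj z w → G.Adj z x → z ∈ t) :
    ∃ Q A B, IsReducingPath G X Y Q A B := by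
  have hy := h.mid_mem hG
  have huX := h.left_mem
  have hwX := h.symm.left_mem
  have hut := h.left_notMem
  have hwt := h.symm.left_notMem
  have hyt' := h.mid_notMem
  have hT := h.isXPath_tail hG
  obtain ⟨s, p, rfl, hp, hyp⟩ := h.exists_pred hG ht hy' hyt hu hyx
    fun c hc => hfar c hc y' hy' hne (.inl hu)
  have ht' : t = s ++ p :: y' :: x :: t₂ := by rw [ht]; simp
  have hsub : ∀ c, c ∈ p :: s.reverse → c ∈ t := by
    intro c hc
    simp only [List.mem_cons, List.mem_reverse] at hc
    simp only [ht', List.mem_append, List.mem_cons]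
    tauto
  have hyR : y' ∉ p :: s.reverse := by
    have hn := hT.nodup
    rw [ht, List.append_assoc] at hn
    have := (List.nodup_append.1 hn).2.2
    simp only [List.mem_cons, List.mem_reverse, not_or]
    refine ⟨hyp.ne, fun hs => this _ hs y' (by simp) rfl⟩
  have hR : IsXPath G X Y (p :: s.reverse) := by
    rw [ht'] at hT
    simpa using (hT.left_of_append hp).reverse
  have hQ₁ : IsXPath G X Y (u :: y' :: p :: s.reverse) :=
    hR.cons_cons huX hy' hu.symm hyp (fun h => hut (hsub _ h)) hyR
  have hQ : IsXPath G X Y (w :: y :: u :: y' :: p :: s.reverse) := by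
    refine hQ₁.cons_cons hwX hy h.symm.adj_left h.adj_left.symm ?_ ?_
    · rw [List.mem_cons, List.mem_cons]
      rintro (rfl | rfl | h')
      · exact h.ne rfl
      · exact hG.disj _ hwX hy'
      · exact hwt (hsub _ h')
    · rw [List.mem_cons, List.mem_cons]
      rintro (rfl | rfl | h')
      · exact hG.disj _ huX hy
      · exact hne rfl
      · exact hyt' (hsub _ h')
  refine ⟨_, {w}, ∅, hQ, by simpa using hwX, by simp, by simp, ?_⟩
  intro z hz _ a ha hza c hc hzc
  obtain rfl := Finset.mem_singleton.1 ha
  refine ⟨?_, fun h => Finset.mem_singleton.1 h⟩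
  by_cases hzy : z = y
  · subst hzy
    obtain ⟨x₂, t', e, -, -⟩ := h.exists_tail hG
    have hx₂ : x₂ ∈ p :: s.reverse := by
      rcases s with _ | ⟨b, s⟩
      · have := (List.cons.inj (e.symm.trans ht')).1
        simp [this]
      · have := (List.cons.inj (e.symm.trans ht')).1
        simp [this]
    rw [e] at h
    rcases h.nbr_mid hG hzc with rfl | rfl | rfl
    · simp
    · simp
    · simp only [List.mem_cons] at hx₂ ⊢
      tauto
  · rcases h.symm.nbr_left hG hz hzy hza hc hzc with rfl | hct
    · simp
    · have h1 : c ∉ t₂ := fun hc2 => hfar c hc2 z hz hzy (.inr hza) hzc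
      have h2 : c ≠ y' := fun h => hG.disj _ hc (h ▸ hy')
      have h3 : c ≠ x := by
        rintro rfl
        obtain ⟨s', p', e, -, -⟩ := h.symm.exists_pred hG ht hz (hin z hz hzy hza hzc) hza hzc
          fun d hd => hfar d hd z hz hzy (.inr hza)
        have hzy' : y' = z := by
          have := congrArg List.getLast? e
          simpa using this
        subst hzy'
        exact h.not_adj_both hG hy' hne hu hza
      simp only [ht', List.mem_append, List.mem_cons] at hct
      simp only [List.mem_cons, List.mem_reverse]
      tauto

lemma exists_reducing (hG : IsThinBigraph G X Y) (h : IsFork G X Y u w y t) :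
    ∃ Q A B, IsReducingPath G X Y Q A B := by
  by_cases hW : ∃ x ∈ t, ∃ y' ∈ Y, y' ≠ y ∧ (G.Adj y' u ∨ G.Adj y' w) ∧ G.Adj y' x
  · obtain ⟨t₁, x, t₂, ht, ⟨y', hy', hne, huw, hyx⟩, hfar⟩ := List.exists_last_split _ t hW
    have hfar' : ∀ c ∈ t₂, ∀ y' ∈ Y, y' ≠ y → (G.Adj y' u ∨ G.Adj y' w) → ¬ G.Adj y' c :=
      fun c hc z hz hzy hzu hzc => hfar c hc ⟨z, hz, hzy, hzu, hzc⟩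
    have hx : x ∈ X := ((h.isXPath_tail hG).mem x (by simp [ht])).resolve_right
      fun hx => hG.indepY _ hy' _ hx hyx
    by_cases hout : ∃ z ∈ Y, z ≠ y ∧ (G.Adj z u ∨ G.Adj z w) ∧ G.Adj z x ∧ z ∉ t
    · obtain ⟨z, hz, hzy, hzu | hzw, hzx, hzt⟩ := hout
      · exact h.exists_reducing_of_outside hG ht hx hfar' hz hzy hzu hzx hzt
      · exact h.symm.exists_reducing_of_outside hG ht hx
          (fun c hc z hz hzy hzu => hfar' c hc z hz hzy hzu.symm) hz hzy hzw hzx hzt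
    · push Not at hout
      have hyt := hout y' hy' hne huw hyx
      rcases huw with hu | hw
      · exact h.exists_reducing_of_inside hG ht hfar' hy' hne hu hyx hyt
          fun z hz hzy hzw => hout z hz hzy (.inr hzw)
      · exact h.symm.exists_reducing_of_inside hG ht
          (fun c hc z hz hzy hzu => hfar' c hc z hz hzy hzu.symm) hy' hne hw hyx hyt
          fun z hz hzy hzw => hout z hz hzy (.inl hzw)
  · push Not at hW
    exact h.exists_reducing_of_no_return hG hW

end IsFork

lemma exists_longest_isXPath [Fintype V] (hX : X.Nonempty) :
    ∃ l, IsXPath G X Y l ∧ ∀ l', IsXPath G X Y l' → l'.length ≤ l.length := by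
  let s : Set ℕ := {n | ∃ l, IsXPath G X Y l ∧ l.length = n}
  have hb : BddAbove s := by
    refine ⟨Fintype.card V, ?_⟩
    rintro n ⟨l, hl, rfl⟩
    exact hl.nodup.length_le_card
  obtain ⟨a, ha⟩ := hX
  obtain ⟨l, hl, hlen⟩ := Nat.sSup_mem (s := s) ⟨_, [a], .singleton ha, rfl⟩ hb
  exact ⟨l, hl, fun l' hl' => hlen ▸ le_csSup hb ⟨l', hl', rfl⟩⟩

lemma exists_isReducingPath [Fintype V] (hG : IsThinBigraph G X Y) (hX : X.Nonempty) :
    ∃ Q A B, IsReducingPath G X Y Q A B := by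
  obtain ⟨l, hl, hmax⟩ := exists_longest_isXPath (G := G) (Y := Y) hX
  rcases l with _ | ⟨v, l⟩
  · simpa using hl.head
  have hv : v ∈ X := by simpa using hl.head
  by_cases hcl : ∀ y ∈ Y, G.Adj y v → ∀ c ∈ X, G.Adj y c → c ∈ v :: l
  · refine ⟨v :: l, {v}, ∅, hl, by simpa using hv, by simp, by simp, ?_⟩
    intro y hy _ a ha hya c hc hyc
    obtain rfl := Finset.mem_singleton.1 ha
    exact ⟨hcl y hy hya c hc hyc, fun h => Finset.mem_singleton.1 h⟩
  · push Not at hcl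
    obtain ⟨y, hy, hyv, c, hc, hyc, hcl⟩ := hcl
    obtain ⟨t, rfl⟩ := hl.exists_eq_cons_cons hG hmax hy hyv hc hyc hcl
    have hfork : IsFork G X Y v c y t := by
      simp only [List.mem_cons, not_or] at hcl
      refine ⟨hl, ?_, fun h => hcl.1 h.symm, by simpa using hmax⟩
      rcases t with _ | ⟨x, t⟩
      · have : y ∈ X := by simpa using hl.last
        exact absurd hy (hG.disj _ this)
      · have hch := hl.chain
        have hn := hl.nodup
        simp only [List.isChain_cons_cons] at hch
        have hx : x ∈ X := (hl.mem x (by simp)).resolve_right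
          fun hx => hG.indepY _ hy _ hx hch.2.1
        exact (IsXPath.right_of_append (l₁ := [v, y]) hl hx).cons_cons hc hy hyc.symm hch.2.1
          (by simpa using hcl.2.2) (List.nodup_cons.1 (List.nodup_cons.1 hn).2).1
    exact hfork.exists_reducing hG

end Fork

lemma mem_lamSet {G : SimpleGraph V} {Y S : Finset V} {y : V} :
    y ∈ lamSet G Y S ↔ y ∈ Y ∧ ∃ a ∈ S, ∃ b ∈ S, G.Adj y a ∧ G.Adj y b ∧ a ≠ b := by
  simp only [lamSet, Finset.mem_filter, Finset.one_lt_card]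
  constructor
  · rintro ⟨hy, a, ⟨ha, hya⟩, b, ⟨hb, hyb⟩, hab⟩
    exact ⟨hy, a, ha, b, hb, hya, hyb, hab⟩
  · rintro ⟨hy, a, ha, b, hb, hya, hyb, hab⟩
    exact ⟨hy, a, ⟨ha, hya⟩, b, ⟨hb, hyb⟩, hab⟩

lemma lamDef_le_iff {G : SimpleGraph V} {X Y : Finset V} {k : ℕ} :
    lamDef G X Y ≤ k ↔ ∀ S ⊆ X, S.card ≤ (lamSet G Y S).card + k := by
  simp only [lamDef, Finset.sup'_le_iff, Finset.mem_powerset, lamDefSet]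
  refine forall₂_congr fun S _ => ?_
  omega

lemma IsThinBigraph.mono {G : SimpleGraph V} {X Y X' Y' : Finset V} (hG : IsThinBigraph G X Y)
    (hX : X' ⊆ X) (hY : Y' ⊆ Y) : IsThinBigraph G X' Y' where
  disj v hv hv' := hG.disj v (hX hv) (hY hv')
  indepX a ha b hb := hG.indepX a (hX ha) b (hX hb)
  indepY a ha b hb := hG.indepY a (hY ha) b (hY hb)
  deg y hy := hG.deg y (hY hy)

lemma IsXPath.mono {G : SimpleGraph V} {X Y X' Y' : Finset V} {l : List V}
    (h : IsXPath G X' Y' l) (hX : X' ⊆ X) (hY : Y' ⊆ Y) : IsXPath G X Y l where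
  chain := h.chain
  nodup := h.nodup
  mem v hv := (h.mem v hv).imp (@hX v) (@hY v)
  head := h.head.imp fun _ ha => ⟨hX ha.1, ha.2⟩
  last := h.last.imp fun _ ha => ⟨hX ha.1, ha.2⟩

lemma IsReducingPath.lamSet_subset {G : SimpleGraph V} {X Y A B S : Finset V} {Q : List V}
    (hG : IsThinBigraph G X Y) (h : IsReducingPath G X Y Q A B) (hS : S ⊆ X \ Q.toFinset) :
    lamSet G Y (S ∪ A) ⊆ lamSet G (Y \ Q.toFinset) S ∪ B := by
  have hSX : ∀ s ∈ S, s ∈ X ∧ s ∉ Q := fun s hs => by simpa using hS hs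
  intro y hy
  obtain ⟨hyY, a, ha, b, hb, hya, hyb, hab⟩ := mem_lamSet.1 hy
  by_cases hyB : y ∈ B
  · exact Finset.mem_union_right _ hyB
  have key : ∀ a b, a ∈ A → b ∈ S ∪ A → G.Adj y a → G.Adj y b → a ≠ b → False := by
    intro a b ha hb hya hyb hab
    rcases Finset.mem_union.1 hb with hb | hb
    · exact (hSX b hb).2 (h.nbr y hyY hyB a ha hya b (hSX b hb).1 hyb).1
    · exact hab ((h.nbr y hyY hyB a ha hya b (h.subset hb) hyb).2 hb).symm
  have haS : a ∈ S := (Finset.mem_union.1 ha).resolve_right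
    fun ha => key a b ha hb hya hyb hab
  have hbS : b ∈ S := (Finset.mem_union.1 hb).resolve_right
    fun hb => key b a hb ha hyb hya hab.symm
  refine Finset.mem_union_left _ (mem_lamSet.2 ⟨?_, a, haS, b, hbS, hya, hyb, hab⟩)
  simp only [Finset.mem_sdiff, List.mem_toFinset, hyY, true_and]
  intro hyQ
  obtain ⟨s, p, q, t, e, hp, hq, -, -, hpq⟩ := h.path.exists_split hG hyY hyQ
  have hpQ : p ∈ Q := by simp [e]
  have hqQ : q ∈ Q := by simp [e]
  have hap : a ≠ p := fun h => (hSX a haS).2 (h ▸ hpQ)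
  have haq : a ≠ q := fun h => (hSX a haS).2 (h ▸ hqQ)
  have hbp : b ≠ p := fun h => (hSX b hbS).2 (h ▸ hpQ)
  have hbq : b ≠ q := fun h => (hSX b hbS).2 (h ▸ hqQ)
  have := hG.deg y hyY [a, b, p, q] (by simp [hab, hap, haq, hbp, hbq, hpq])
    (by simp [hya, hyb, hp, hq])
  simp at this

lemma exists_isXPath_cover [Fintype V] {G : SimpleGraph V} {X Y : Finset V} {k : ℕ}
    (hG : IsThinBigraph G X Y) (hdef : ∀ S ⊆ X, S.card ≤ (lamSet G Y S).card + k) :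
    ∃ L : List (List V), L.length ≤ k ∧ (∀ l ∈ L, IsXPath G X Y l) ∧
      L.Pairwise (fun p q => ∀ v ∈ p, v ∉ q) ∧ ∀ x ∈ X, ∃ l ∈ L, x ∈ l := by
  induction hn : X.card using Nat.strong_induction_on generalizing X Y k with
  | _ n ih =>
    rcases X.eq_empty_or_nonempty with rfl | hX
    · exact ⟨[], by simp⟩
    obtain ⟨Q, A, B, hQ⟩ := exists_isReducingPath hG hX
    obtain ⟨a, ha⟩ : A.Nonempty := Finset.card_pos.1 (by have := hQ.card; omega)
    have hk : 1 ≤ k := by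
      have h0 : lamSet G Y {a} = ∅ := by
        refine Finset.eq_empty_of_forall_notMem fun y hy => ?_
        obtain ⟨-, b, hb, c, hc, -, -, hbc⟩ := mem_lamSet.1 hy
        rw [Finset.mem_singleton] at hb hc
        exact hbc (hb.trans hc.symm)
      simpa [h0] using hdef {a} (by simpa using hQ.subset ha)
    have hXs : X \ Q.toFinset ⊆ X := Finset.sdiff_subset
    have hYs : Y \ Q.toFinset ⊆ Y := Finset.sdiff_subset
    have hlt : (X \ Q.toFinset).card < n := by
      rw [← hn]
      refine Finset.card_lt_card (Finset.ssubset_iff_subset_ne.2 ⟨hXs, fun h => ?_⟩)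
      have := hQ.subset ha
      rw [← h] at this
      simp [hQ.mem a ha] at this
    obtain ⟨L, hL1, hL2, hL3, hL4⟩ := ih _ hlt (k := k - 1) (hG.mono hXs hYs) (fun S hS => by
      have h1 := hdef (S ∪ A) (Finset.union_subset (hS.trans hXs) hQ.subset)
      have h2 := (Finset.card_le_card (hQ.lamSet_subset hG hS)).trans (Finset.card_union_le _ _)
      have h3 : (S ∪ A).card = S.card + A.card := by
        refine Finset.card_union_of_disjoint (Finset.disjoint_left.2 fun s hs hsA => ?_)
        have := hS hs
        simp [hQ.mem s hsA] at this
      have h4 := hQ.card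
      omega) rfl
    refine ⟨Q :: L, by simp only [List.length_cons]; omega, ?_, ?_, ?_⟩
    · intro l hl
      rcases List.mem_cons.1 hl with rfl | hl
      · exact hQ.path
      · exact (hL2 l hl).mono hXs hYs
    · refine List.pairwise_cons.2 ⟨fun l hl v hv hvl => ?_, hL3⟩
      have := (hL2 l hl).mem v hvl
      simp [hv] at this
    · intro x hx
      by_cases hxQ : x ∈ Q
      · exact ⟨Q, by simp, hxQ⟩
      · obtain ⟨l, hl, hxl⟩ := hL4 x (by simp [hx, hxQ])
        exact ⟨l, by simp [hl], hxl⟩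

lemma countP_le_countP_lamSet {G : SimpleGraph V} {X Y S : Finset V} (hBG : IsBigraph G X Y)
    (hSX : S ⊆ X) : ∀ l : List V, l.IsChain G.Adj → l.Nodup → (∀ v ∈ l, v ∈ X → v ∈ S) →
      l.countP (· ∈ S) ≤ l.countP (· ∈ lamSet G Y S) + 1
  | [], _, _, _ => by simp
  | [a], _, _, _ => by
    have := List.countP_le_length (p := (· ∈ S)) (l := [a])
    simp only [List.length_singleton] at this
    omega
  | a :: b :: l, hc, hn, hS => by
    simp only [List.isChain_cons_cons] at hc
    have ih₁ := countP_le_countP_lamSet hBG hSX (b :: l) hc.2 (List.nodup_cons.1 hn).2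
      fun v hv => hS v (List.mem_cons_of_mem _ hv)
    by_cases ha : a ∈ S
    · have hb : b ∈ Y ∧ b ∉ X := by
        rcases hBG.2.2 hc.1 with h | h
        · exact ⟨h.2, fun hb => Finset.disjoint_left.1 hBG.1 hb h.2⟩
        · exact absurd h.1 (Finset.disjoint_left.1 hBG.1 (hSX ha))
      have hbS : b ∉ S := fun h => hb.2 (hSX h)
      rcases l with _ | ⟨c, l⟩
      · simp [List.countP_cons, ha, hbS]
      · have ih₂ := countP_le_countP_lamSet hBG hSX (c :: l) hc.2.of_cons
          (List.nodup_cons.1 (List.nodup_cons.1 hn).2).2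
          fun v hv => hS v (List.mem_cons_of_mem _ (List.mem_cons_of_mem _ hv))
        have hbc := (List.isChain_cons_cons.1 hc.2).1
        have hcS : c ∈ S := by
          refine hS c (by simp) ?_
          rcases hBG.2.2 hbc with h | h
          · exact absurd h.1 hb.2
          · exact h.2
        have hac : a ≠ c := by
          rintro rfl
          simp at hn
        have hbΛ : b ∈ lamSet G Y S := mem_lamSet.2 ⟨hb.1, a, ha, c, hcS, hc.1.symm, hbc, hac⟩
        rw [List.countP_cons_of_pos (by simpa using ha), List.countP_cons_of_neg (by simpa using hbS)]
        rw [List.countP_cons (a := a), List.countP_cons_of_pos (a := b) (by simpa using hbΛ)]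
        omega
    · rw [List.countP_cons_of_neg (by simpa using ha)]
      rw [List.countP_cons (a := a)]
      omega

lemma card_le_of_cover {G : SimpleGraph V} {X Y S : Finset V} (hBG : IsBigraph G X Y)
    (hSX : S ⊆ X) (L : List (List V)) (hchain : ∀ l ∈ L, l.IsChain G.Adj)
    (hn : L.flatten.Nodup) (hL : ∀ x ∈ X, x ∈ L.flatten ↔ x ∈ S) :
    S.card ≤ (lamSet G Y S).card + L.length := by
  have h1 : L.flatten.countP (· ∈ S) ≤ L.flatten.countP (· ∈ lamSet G Y S) + L.length := by
    have hS : ∀ l ∈ L, ∀ v ∈ l, v ∈ X → v ∈ S :=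
      fun l hl v hv hvX => (hL v hvX).1 (List.mem_flatten.2 ⟨l, hl, hv⟩)
    clear hL
    induction L with
    | nil => simp
    | cons l L ih =>
      rw [List.flatten_cons] at hn ⊢
      have hn' := List.nodup_append.1 hn
      have h1 := ih (fun l hl => hchain l (List.mem_cons_of_mem _ hl)) hn'.2.1
        fun l hl => hS l (List.mem_cons_of_mem _ hl)
      have h2 := countP_le_countP_lamSet hBG hSX l (hchain l (by simp)) hn'.1 (hS l (by simp))
      rw [List.countP_append, List.countP_append, List.length_cons]
      omega
  have hcount : ∀ T : Finset V,
      L.flatten.countP (· ∈ T) = (L.flatten.toFinset.filter (· ∈ T)).card := by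
    intro T
    rw [List.countP_eq_length_filter, ← List.toFinset_card_of_nodup (hn.filter _),
      List.toFinset_filter]
    simp
  rw [hcount, hcount] at h1
  have h2 : S ⊆ L.flatten.toFinset.filter (· ∈ S) := fun x hx =>
    Finset.mem_filter.2 ⟨List.mem_toFinset.2 ((hL x (hSX hx)).2 hx), hx⟩
  have h3 : L.flatten.toFinset.filter (· ∈ lamSet G Y S) ⊆ lamSet G Y S := fun x hx =>
    (Finset.mem_filter.1 hx).2
  have h4 := Finset.card_le_card h2
  have h5 := Finset.card_le_card h3
  omega

lemma IsBigraph.isThinBigraph [Fintype V] {G : SimpleGraph V} [DecidableRel G.Adj]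
    {X Y : Finset V} (hBG : IsBigraph G X Y) (hdeg : ∀ v : V, G.degree v ≤ 3) :
    IsThinBigraph G X Y where
  disj v hv := Finset.disjoint_left.1 hBG.1 hv
  indepX a ha b hb hab := by
    rcases hBG.2.2 hab with h | h
    exacts [Finset.disjoint_left.1 hBG.1 hb h.2, Finset.disjoint_left.1 hBG.1 ha h.1]
  indepY a ha b hb hab := by
    rcases hBG.2.2 hab with h | h
    exacts [Finset.disjoint_left.1 hBG.1 h.1 ha, Finset.disjoint_left.1 hBG.1 h.2 hb]
  deg y _ l hl hadj := by
    rw [← List.toFinset_card_of_nodup hl]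
    refine le_trans ?_ (hdeg y)
    rw [← SimpleGraph.card_neighborFinset_eq_degree]
    exact Finset.card_le_card fun a ha => by simpa using hadj a (by simpa using ha)

/-- For an `(X,Y)`-bigraph `G` of maximum degree at most `3`
and `k ≥ 0`: `def(G) ≤ k` iff for every `S ⊆ X` there is a set of at most `k`
pairwise vertex-disjoint paths whose union of vertex sets intersects `X`
exactly in `S`. -/
theorem maxDegree_three_iff {V : Type*} [Fintype V] (G : SimpleGraph V)
    [DecidableRel G.Adj] (X Y : Finset V) (hBG : IsBigraph G X Y)
    (hdeg : ∀ v : V, G.degree v ≤ 3) (k : ℕ) :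
    lamDef G X Y ≤ (k : ℤ) ↔
      ∀ S ⊆ X, ∃ P : List (Σ u : V, Σ v : V, G.Walk u v),
        IsPathExactCover G X S P ∧ P.length ≤ k := by
  rw [lamDef_le_iff]
  constructor
  · intro h S hS
    obtain ⟨L, hlen, hpath, hdisj, hcov⟩ := exists_isXPath_cover
      ((hBG.isThinBigraph hdeg).mono hS (subset_refl Y)) fun T hT => h T (hT.trans hS)
    have hwalk : ∀ l : {l // l ∈ L}, ∃ p : Σ u : V, Σ v : V, G.Walk u v, p.2.2.support = l.1 := by
      rintro ⟨l, hl⟩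
      have hne : l ≠ [] := by
        rintro rfl
        simpa using (hpath _ hl).head
      exact ⟨⟨_, _, Walk.ofSupport l hne (hpath l hl).chain⟩, Walk.support_ofSupport _ _⟩
    choose f hf using hwalk
    refine ⟨L.attach.map f, ⟨?_, ?_, ?_⟩, by simpa using hlen⟩
    · intro p hp
      obtain ⟨l, -, rfl⟩ := List.mem_map.1 hp
      rw [Walk.isPath_def, hf]
      exact (hpath l.1 l.2).nodup
    · rw [List.pairwise_map]
      simp only [hf]
      rw [← List.pairwise_map (f := Subtype.val) (R := fun p q : List V => ∀ w, w ∈ p → w ∉ q),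
        List.attach_map_subtype_val]
      exact hdisj
    · intro x hx
      constructor
      · rintro ⟨p, hp, hxp⟩
        obtain ⟨l, -, rfl⟩ := List.mem_map.1 hp
        rw [hf] at hxp
        exact ((hpath l.1 l.2).mem x hxp).resolve_right (Finset.disjoint_left.1 hBG.1 hx)
      · intro hxS
        obtain ⟨l, hl, hxl⟩ := hcov x hxS
        exact ⟨f ⟨l, hl⟩, List.mem_map.2 ⟨_, List.mem_attach _ _, rfl⟩, by rwa [hf]⟩
  · intro h S hS
    obtain ⟨P, ⟨hpath, hdisj, hcov⟩, hlen⟩ := h S hS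
    have := card_le_of_cover hBG hS (P.map fun p => p.2.2.support) ?_ ?_ ?_
    · rw [List.length_map] at this
      omega
    · intro l hl
      obtain ⟨p, -, rfl⟩ := List.mem_map.1 hl
      exact p.2.2.isChain_adj_support
    · rw [List.nodup_flatten, List.pairwise_map]
      refine ⟨?_, hdisj⟩
      intro l hl
      obtain ⟨p, hp, rfl⟩ := List.mem_map.1 hl
      exact (hpath p hp).support_nodup
    · intro x hx
      rw [← hcov x hx]
      simp [List.mem_flatten]
end

section
/- Let n and k be integers with 1 ≤ k and 2k ≤ n. Let G be the (X,Y)-bigraph with X = {x_1, …, x_n}, Y = {y_1, …, y_n}, and x_i adjacent to y_j if and only if i ≤ k or j ≤ k. Then α_Λ(G) = 1 and def(G) ≥ n − 2k + 1. -/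
open Finset SimpleGraph
open scoped Classical

variable {V : Type*}

lemma card_le_alphaLam {G : SimpleGraph V} {X Y S : Finset V} (hSX : S ⊆ X)
    (hS : lamSet G Y S = ∅) : S.card ≤ alphaLam G X Y :=
  Finset.le_sup (f := Finset.card) (Finset.mem_filter.2 ⟨Finset.mem_powerset.2 hSX, hS⟩)

lemma alphaLam_le {G : SimpleGraph V} {X Y : Finset V} {m : ℕ}
    (h : ∀ S ⊆ X, lamSet G Y S = ∅ → S.card ≤ m) : alphaLam G X Y ≤ m :=
  Finset.sup_le fun S hS =>
    h S (Finset.mem_powerset.1 (Finset.mem_filter.1 hS).1) (Finset.mem_filter.1 hS).2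

lemma lamDefSet_le_lamDef {G : SimpleGraph V} {X Y S : Finset V} (hSX : S ⊆ X) :
    lamDefSet G Y S ≤ lamDef G X Y :=
  Finset.le_sup' (fun S => lamDefSet G Y S) (Finset.mem_powerset.2 hSX)

/-- For `1 ≤ k` and `2k ≤ n`, the `(X,Y)`-bigraph on
`X = {x_1, …, x_n}`, `Y = {y_1, …, y_n}` with `x_i ~ y_j` iff `i ≤ k` or
`j ≤ k` satisfies `α_Λ(G) = 1` and `def(G) ≥ n − 2k + 1`. -/
theorem example_graph_alpha_def (n k : ℕ) (hk : 1 ≤ k) (hkn : 2 * k ≤ n)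
    (G : SimpleGraph (Fin n ⊕ Fin n))
    (hadj : ∀ u v : Fin n ⊕ Fin n, G.Adj u v ↔
      match u, v with
      | Sum.inl i, Sum.inr j => i.val < k ∨ j.val < k
      | Sum.inr j, Sum.inl i => i.val < k ∨ j.val < k
      | _, _ => False) :
    alphaLam G (Finset.univ.image Sum.inl) (Finset.univ.image Sum.inr) = 1 ∧
      (n : ℤ) - 2 * (k : ℤ) + 1 ≤
        lamDef G (Finset.univ.image Sum.inl) (Finset.univ.image Sum.inr) := by
  have adj : ∀ i j : Fin n, G.Adj (Sum.inr j) (Sum.inl i) ↔ i.val < k ∨ j.val < k :=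
    fun i j => hadj _ _
  constructor
  · apply le_antisymm
    · refine alphaLam_le fun S hSX hS => ?_
      by_contra! hcard
      have hmem : (Sum.inr ⟨0, by omega⟩ : Fin n ⊕ Fin n) ∈
          lamSet G (Finset.univ.image Sum.inr) S := by
        refine Finset.mem_filter.2 ⟨Finset.mem_image_of_mem _ (Finset.mem_univ _), ?_⟩
        rwa [Finset.filter_true_of_mem]
        intro x hx
        obtain ⟨i, -, rfl⟩ := Finset.mem_image.1 (hSX hx)
        exact (adj _ _).2 (Or.inr hk)
      rw [hS] at hmem
      exact Finset.notMem_empty _ hmem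
    · refine (Finset.card_singleton _).ge.trans
        (card_le_alphaLam (S := {Sum.inl ⟨0, by omega⟩}) (by simp) ?_)
      refine Finset.filter_eq_empty_iff.2 fun y _ => not_lt.2 ?_
      exact (Finset.card_filter_le _ _).trans (Finset.card_singleton _).le
  · set S : Finset (Fin n ⊕ Fin n) :=
      (Finset.Ici (⟨k - 1, by omega⟩ : Fin n)).map Function.Embedding.inl with hS
    have hSX : S ⊆ Finset.univ.image Sum.inl := by
      intro x hx
      obtain ⟨i, -, rfl⟩ := Finset.mem_map.1 hx
      exact Finset.mem_image_of_mem _ (Finset.mem_univ _)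
    have hcard : S.card = n - (k - 1) := by rw [hS, Finset.card_map, Fin.card_Ici]
    have hsub : lamSet G (Finset.univ.image Sum.inr) S ⊆
        (Finset.Iio (⟨k, by omega⟩ : Fin n)).map Function.Embedding.inr := by
      intro y hy
      obtain ⟨hyY, hy⟩ := Finset.mem_filter.1 hy
      obtain ⟨j, -, rfl⟩ := Finset.mem_image.1 hyY
      refine Finset.mem_map.2 ⟨j, Finset.mem_Iio.2 ?_, rfl⟩
      by_contra hj
      rw [Fin.lt_def] at hj
      have key : ∀ x ∈ S, G.Adj (Sum.inr j) x → x = Sum.inl ⟨k - 1, by omega⟩ := by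
        intro x hx hxj
        obtain ⟨i, hi, rfl⟩ := Finset.mem_map.1 hx
        have hi : k - 1 ≤ i.val := Fin.le_def.1 (Finset.mem_Ici.1 hi)
        have hik := ((adj i j).1 hxj).resolve_right hj
        exact congrArg Sum.inl (Fin.ext (by simp only; omega))
      obtain ⟨a, ha, b, hb, hab⟩ := Finset.one_lt_card.1 hy
      rw [Finset.mem_filter] at ha hb
      exact hab ((key a ha.1 ha.2).trans (key b hb.1 hb.2).symm)
    have hle := Finset.card_le_card hsub
    rw [Finset.card_map, Fin.card_Iio] at hle
    refine le_trans ?_ (lamDefSet_le_lamDef hSX)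
    simp only [lamDefSet] at hle ⊢
    omega
end
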